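/- arXiv:2507.17525 — 3 statements merged into one kernel-verified Lean document; each statement's English description precedes it below -/
import Mathlib

section
/- Let A, B ∈ 𝓛(ℋ) be selfadjoint with B indefinite, and assume ⟨Ax, x⟩ ≥ 0 whenever ⟨Bx, x⟩ = 0. Then ⟨Ay, y⟩/⟨By, y⟩ ≤ ⟨Az, z⟩/⟨Bz, z⟩ for every y, z ∈ ℋ with ⟨By, y⟩ < 0 and ⟨Bz, z⟩ > 0. Moreover, setting λ₋ = −inf{⟨Ax, x⟩/⟨Bx, x⟩ : ⟨Bx, x⟩ > 0} and λ₊ = −sup{⟨Ax, x⟩/⟨Bx, x⟩ : ⟨Bx, x⟩ < 0}, one has λ₋ ≤ λ₊ and {λ ∈ ℝ : A + λB ≥ 0} = [λ₋, λ₊]. -/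
open scoped InnerProductSpace

variable {H : Type*} [NormedAddCommGroup H] [InnerProductSpace ℂ H] [CompleteSpace H]

/-- The real quadratic form `x ↦ Re⟨B x, x⟩` associated to a bounded operator `B`. -/
noncomputable def qf (B : H →L[ℂ] H) (x : H) : ℝ := (⟪B x, x⟫_ℂ).re

/-- An operator `A` is positive semidefinite if `⟨A x, x⟩ ≥ 0` for all `x`. -/
def PosSemidef (A : H →L[ℂ] H) : Prop := ∀ x : H, 0 ≤ qf A x

/-- A selfadjoint operator is indefinite if its quadratic form takes both strictly
positive and strictly negative values. -/
def Indefinite (B : H →L[ℂ] H) : Prop := (∃ x : H, 0 < qf B x) ∧ (∃ x : H, qf B x < 0)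

theorem qf_add_smul {T : H →L[ℂ] H} (hT : IsSelfAdjoint T) (x y : H) (t : ℝ) :
    qf T (x + (t : ℂ) • y) = qf T x + 2 * t * (⟪T x, y⟫_ℂ).re + t ^ 2 * qf T y := by
  have hsymm : (⟪T y, x⟫_ℂ).re = (⟪T x, y⟫_ℂ).re := by
    rw [show ⟪T y, x⟫_ℂ = ⟪y, T x⟫_ℂ from hT.isSymmetric y x]
    exact inner_re_symm (𝕜 := ℂ) y (T x)
  simp only [qf, map_add, map_smul, inner_add_left, inner_add_right, inner_smul_left,
    inner_smul_right, Complex.conj_ofReal, Complex.add_re, Complex.re_ofReal_mul, hsymm]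
  ring

set_option linter.unusedSectionVars false in
theorem qf_smul (T : H →L[ℂ] H) (c : ℂ) (x : H) : qf T (c • x) = Complex.normSq c * qf T x := by
  simp only [qf, map_smul, inner_smul_left, inner_smul_right]
  rw [← mul_assoc, Complex.mul_conj, Complex.re_ofReal_mul]

set_option linter.unusedSectionVars false in
theorem qf_add_real_smul (A B : H →L[ℂ] H) (l : ℝ) (x : H) :
    qf (A + l • B) x = qf A x + l * qf B x := by
  simp [qf, inner_smul_left_eq_smul]

/-- A real quadratic polynomial with negative value at `0` and positive leading coefficient
has a real root. -/
theorem exists_quadratic_root {a b c : ℝ} (ha : 0 < a) (hc : c < 0) :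
    ∃ t : ℝ, c + 2 * t * b + t ^ 2 * a = 0 := by
  have hd : 0 ≤ discrim a (2 * b) c := by
    unfold discrim
    nlinarith [sq_nonneg b, mul_pos ha (neg_pos.mpr hc)]
  obtain ⟨t, ht⟩ := exists_quadratic_eq_zero (b := 2 * b) (c := c) ha.ne'
    ⟨√(discrim a (2 * b) c), (Real.mul_self_sqrt hd).symm⟩
  exact ⟨t, by linarith⟩

/-- If a selfadjoint form vanishes at `z` and is nonnegative on the neutral cone of `B`,
then it is nonnegative on the negative cone of `B`, provided `z` is `B`-positive. -/
theorem qf_nonneg_of_neg {C B : H →L[ℂ] H} (hC : IsSelfAdjoint C) (hB : IsSelfAdjoint B)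
    (hCB : ∀ x : H, qf B x = 0 → 0 ≤ qf C x) {y z : H} (hy : qf B y < 0) (hz : 0 < qf B z)
    (hCz : qf C z = 0) : 0 ≤ qf C y := by
  obtain ⟨c, hc, hcross⟩ : ∃ c : ℂ, c ≠ 0 ∧ (c * ⟪C y, z⟫_ℂ).re = 0 := by
    by_cases hw : ⟪C y, z⟫_ℂ = 0
    · exact ⟨1, one_ne_zero, by simp [hw]⟩
    · refine ⟨Complex.I * (starRingEnd ℂ) ⟪C y, z⟫_ℂ, mul_ne_zero Complex.I_ne_zero ((map_ne_zero _).mpr hw), ?_⟩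
      rw [mul_assoc, mul_comm ((starRingEnd ℂ) _), Complex.mul_conj]
      simp
  have hBz : 0 < qf B (c • z) := by
    rw [qf_smul]
    exact mul_pos (Complex.normSq_pos.mpr hc) hz
  obtain ⟨t, ht⟩ := exists_quadratic_root (b := (⟪B y, c • z⟫_ℂ).re) hBz hy
  have h := hCB (y + (t : ℂ) • c • z) ((qf_add_smul hB _ _ _).trans ht)
  rw [qf_add_smul hC, qf_smul, hCz, inner_smul_right, hcross] at h
  simpa using h

theorem qf_div_le_qf_div {A B : H →L[ℂ] H} (hA : IsSelfAdjoint A) (hB : IsSelfAdjoint B)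
    (hAQ : ∀ x : H, qf B x = 0 → 0 ≤ qf A x) {y z : H} (hy : qf B y < 0) (hz : 0 < qf B z) :
    qf A y / qf B y ≤ qf A z / qf B z := by
  have hC : IsSelfAdjoint (A + (-(qf A z / qf B z)) • B) := by
    refine hA.add ?_
    rw [IsSelfAdjoint, star_smul, star_trivial, hB.star_eq]
  have h := qf_nonneg_of_neg hC hB (fun x hx => by
    rw [qf_add_real_smul, hx, mul_zero, add_zero]; exact hAQ x hx) hy hz (by
    rw [qf_add_real_smul]; field_simp; ring)
  rw [qf_add_real_smul] at h
  rw [div_le_iff_of_neg hy]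
  linarith

set_option linter.unusedSectionVars false in
theorem posSemidef_add_real_smul_iff {A B : H →L[ℂ] H}
    (hAQ : ∀ x : H, qf B x = 0 → 0 ≤ qf A x) (l : ℝ) :
    PosSemidef (A + l • B) ↔ (∀ x : H, 0 < qf B x → -l ≤ qf A x / qf B x) ∧
      ∀ x : H, qf B x < 0 → qf A x / qf B x ≤ -l := by
  simp only [PosSemidef, qf_add_real_smul]
  refine ⟨fun h => ⟨fun x hx => ?_, fun x hx => ?_⟩, fun ⟨hp, hn⟩ x => ?_⟩
  · rw [le_div_iff₀ hx]
    linarith [h x]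
  · rw [div_le_iff_of_neg hx]
    linarith [h x]
  · rcases lt_trichotomy (qf B x) 0 with hx | hx | hx
    · have := hn x hx
      rw [div_le_iff_of_neg hx] at this
      linarith
    · simpa [hx] using hAQ x hx
    · have := hp x hx
      rw [le_div_iff₀ hx] at this
      linarith

/-- **Krein–Šmul'jan theorem** (quantitative part): under the feasibility condition,
the ratios `⟨Ay,y⟩/⟨By,y⟩` on the negative cone lie below those on the positive cone,
`λ₋ ≤ λ₊`, and the feasibility set `{λ : A + λB ≥ 0}` is exactly `[λ₋, λ₊]`. -/
theorem krein_smuljan_interval (A B : H →L[ℂ] H) (hA : IsSelfAdjoint A)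
    (hB : IsSelfAdjoint B) (hBind : Indefinite B)
    (hAQ : ∀ x : H, qf B x = 0 → 0 ≤ qf A x) :
    (∀ y z : H, qf B y < 0 → 0 < qf B z →
      qf A y / qf B y ≤ qf A z / qf B z) ∧
    (-sInf {r : ℝ | ∃ x : H, 0 < qf B x ∧ r = qf A x / qf B x} ≤
      -sSup {r : ℝ | ∃ x : H, qf B x < 0 ∧ r = qf A x / qf B x}) ∧
    {l : ℝ | PosSemidef (A + l • B)} =
      Set.Icc (-sInf {r : ℝ | ∃ x : H, 0 < qf B x ∧ r = qf A x / qf B x})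
        (-sSup {r : ℝ | ∃ x : H, qf B x < 0 ∧ r = qf A x / qf B x}) := by
  have hle : ∀ y z : H, qf B y < 0 → 0 < qf B z → qf A y / qf B y ≤ qf A z / qf B z :=
    fun y z hy hz => qf_div_le_qf_div hA hB hAQ hy hz
  obtain ⟨⟨z, hz⟩, ⟨y, hy⟩⟩ := hBind
  set P := {r : ℝ | ∃ x : H, 0 < qf B x ∧ r = qf A x / qf B x} with hP
  set N := {r : ℝ | ∃ x : H, qf B x < 0 ∧ r = qf A x / qf B x} with hN
  have hPne : P.Nonempty := ⟨_, z, hz, rfl⟩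
  have hNne : N.Nonempty := ⟨_, y, hy, rfl⟩
  have hNP : ∀ n ∈ N, ∀ p ∈ P, n ≤ p := by
    rintro _ ⟨u, hu, rfl⟩ _ ⟨v, hv, rfl⟩
    exact hle u v hu hv
  have hPb : BddBelow P := ⟨_, hNP _ hNne.choose_spec⟩
  have hNb : BddAbove N := ⟨_, fun n hn => hNP n hn _ hPne.choose_spec⟩
  refine ⟨hle, neg_le_neg (csSup_le hNne fun n hn => le_csInf hPne (hNP n hn)), ?_⟩
  ext l
  rw [Set.mem_ofPred_eq, posSemidef_add_real_smul_iff hAQ, Set.mem_Icc, neg_le, le_neg,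
    le_csInf_iff hPb hPne, csSup_le_iff hNb hNne]
  simp only [hP, hN, Set.mem_ofPred_eq]
  constructor
  · rintro ⟨hp, hn⟩
    exact ⟨by rintro _ ⟨x, hx, rfl⟩; exact hp x hx, by rintro _ ⟨x, hx, rfl⟩; exact hn x hx⟩
  · rintro ⟨hp, hn⟩
    exact ⟨fun x hx => hp _ ⟨x, hx, rfl⟩, fun x hx => hn _ ⟨x, hx, rfl⟩⟩
end

section
/- Let A, B₁, B₂ ∈ 𝓛(ℋ) be selfadjoint and assume {B₁, B₂} is weakly indefinite. Then ⟨Ax, x⟩ ≥ 0 for every x ∈ Q₁ ∩ Q₂ if and only if there exist λ₁, λ₂ ∈ ℝ with A + λ₁B₁ + λ₂B₂ ≥ 0. -/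
open scoped InnerProductSpace

variable {H : Type*} [NormedAddCommGroup H] [InnerProductSpace ℂ H] [CompleteSpace H]

/-- `Q(B)` : the set of neutral vectors of the quadratic form of `B`. -/
def Qset (B : H →L[ℂ] H) : Set H := {x : H | qf B x = 0}

/-- `B` is indefinite on a set `S` if its quadratic form takes both strictly positive
and strictly negative values on `S`. -/
def IndefiniteOn (B : H →L[ℂ] H) (S : Set H) : Prop :=
  (∃ x ∈ S, 0 < qf B x) ∧ (∃ x ∈ S, qf B x < 0)

/-- A family `{B₁,…,B_m}` is weakly indefinite if every nontrivial real linear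
combination `∑ μᵢ Bᵢ` is indefinite. -/
def WeaklyIndefinite {m : ℕ} (B : Fin m → (H →L[ℂ] H)) : Prop :=
  ∀ μ : Fin m → ℝ, μ ≠ 0 → Indefinite (∑ i, μ i • B i)

/-- A family `{B₁,…,B_m}` is indefinite if each `B_j` is indefinite on `⋂_{i≠j} Qᵢ`. -/
def IndefiniteFamily {m : ℕ} (B : Fin m → (H →L[ℂ] H)) : Prop :=
  ∀ j : Fin m, IndefiniteOn (B j) {x : H | ∀ i, i ≠ j → qf (B i) x = 0}

lemma qf_smul_add_smul {B : H →L[ℂ] H} (hB : IsSelfAdjoint B) (x y : H) (α : ℝ) (β : ℂ) :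
    qf B ((α : ℂ) • x + β • y) =
      α ^ 2 * qf B x + ‖β‖ ^ 2 * qf B y + 2 * α * (β * ⟪B x, y⟫_ℂ).re := by
  have hyx : ⟪B y, x⟫_ℂ = starRingEnd ℂ ⟪B x, y⟫_ℂ := by
    rw [inner_conj_symm]
    exact hB.isSymmetric y x
  have hβ : ‖β‖ ^ 2 = β.re * β.re + β.im * β.im := by
    rw [← Complex.normSq_eq_norm_sq, Complex.normSq_apply]
  simp only [qf, map_add, map_smul, inner_add_left, inner_add_right, inner_smul_left,
    inner_smul_right, hyx, hβ, Complex.add_re, Complex.add_im, Complex.mul_re, Complex.mul_im, Complex.conj_re,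
    Complex.conj_im, Complex.ofReal_re, Complex.ofReal_im]
  ring

lemma qf_real_smul {E : Type*} [NormedAddCommGroup E] [InnerProductSpace ℂ E]
    (B : E →L[ℂ] E) (c : ℝ) (x : E) :
    qf B (c • x) = c ^ 2 * qf B x := by
  rw [← Complex.coe_smul]
  simp only [qf, map_smul, inner_smul_left, inner_smul_right, Complex.mul_re, Complex.mul_im,
    Complex.conj_re, Complex.conj_im, Complex.ofReal_re, Complex.ofReal_im]
  ring

lemma qf_add {E : Type*} [NormedAddCommGroup E] [InnerProductSpace ℂ E]
    (B C : E →L[ℂ] E) (x : E) : qf (B + C) x = qf B x + qf C x := by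
  simp [qf]

lemma qf_smul_s7 {E : Type*} [NormedAddCommGroup E] [InnerProductSpace ℂ E]
    (c : ℝ) (B : E →L[ℂ] E) (x : E) : qf (c • B) x = c * qf B x := by
  have : (c • B) x = (c : ℂ) • B x := by simp
  simp [qf, this]

/-- Three real linear equations in the four-dimensional space of Hermitian `2 × 2` matrices have
a nonzero solution. -/
lemma exists_hermitian_relation (a b : Fin 3 → ℝ) (w : Fin 3 → ℂ) :
    ∃ (p r : ℝ) (ζ : ℂ), 0 ≤ p + r ∧ (p ≠ 0 ∨ r ≠ 0 ∨ ζ ≠ 0) ∧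
      ∀ i, p * a i + r * b i + 2 * (ζ * w i).re = 0 := by
  let f : (ℝ × ℝ × ℂ) →ₗ[ℝ] (Fin 3 → ℝ) :=
    { toFun := fun v i => v.1 * a i + v.2.1 * b i + 2 * (v.2.2 * w i).re
      map_add' := fun u v => by
        ext i; simp only [Prod.fst_add, Prod.snd_add, add_mul, Complex.add_re, Pi.add_apply]; ring
      map_smul' := fun c v => by
        ext i; simp; ring }
  have hker : LinearMap.ker f ≠ ⊥ := LinearMap.ker_ne_bot_of_finrank_lt (by simp)
  obtain ⟨⟨p, r, ζ⟩, hv, hne⟩ := Submodule.exists_mem_ne_zero_of_ne_bot hker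
  have heq (i : Fin 3) : p * a i + r * b i + 2 * (ζ * w i).re = 0 := congrFun hv i
  have hne' : p ≠ 0 ∨ r ≠ 0 ∨ ζ ≠ 0 := by
    by_contra! h
    exact hne (by simp [h.1, h.2.1, h.2.2])
  rcases le_total 0 (p + r) with h | h
  · exact ⟨p, r, ζ, h, hne', heq⟩
  · refine ⟨-p, -r, -ζ, by linarith, by simpa using hne', fun i => ?_⟩
    have := heq i
    simp only [neg_mul, Complex.neg_re]
    linarith

/-- A nonzero Hermitian `2 × 2` matrix `N` with nonnegative trace has a positive largest
eigenvalue `l`, and `1 - N / l` is positive semidefinite of rank at most one. -/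
lemma exists_rank_one_sub {p r : ℝ} {ζ : ℂ} (hs : 0 ≤ p + r)
    (hne : p ≠ 0 ∨ r ≠ 0 ∨ ζ ≠ 0) :
    ∃ (l α : ℝ) (β : ℂ), 0 < l ∧ l * α ^ 2 = l - p ∧ l * ‖β‖ ^ 2 = l - r ∧
      (l : ℂ) * (α * β) = -ζ := by
  set D := (p - r) ^ 2 + 4 * ‖ζ‖ ^ 2 with hD
  have hD0 : 0 ≤ D := by positivity
  have hsq : √D ^ 2 = D := Real.sq_sqrt hD0
  have habs : |p - r| ≤ √D := Real.abs_le_sqrt (by rw [hD]; nlinarith [sq_nonneg ‖ζ‖])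
  obtain ⟨hl₁, hl₂⟩ := abs_le.1 habs
  obtain ⟨l, hl⟩ : ∃ l, l = (p + r + √D) / 2 := ⟨_, rfl⟩
  have hlp : 0 ≤ l - p := by linarith
  have hlr : 0 ≤ l - r := by linarith
  have hdet : (l - p) * (l - r) = ‖ζ‖ ^ 2 := by subst hl; nlinarith
  have hl0 : 0 < l := by
    refine lt_of_le_of_ne (by linarith [Real.sqrt_nonneg D]) fun h0 => ?_
    have hp : p = 0 := by linarith [Real.sqrt_nonneg D]
    have hr : r = 0 := by linarith [Real.sqrt_nonneg D]
    have hζ : ζ = 0 := by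
      rw [← h0, hp, hr] at hdet
      simpa using hdet.symm
    simp [hp, hr, hζ] at hne
  rcases hlp.eq_or_lt with h | h
  · have hζ : ζ = 0 := by
      rw [← h] at hdet
      simpa using hdet.symm
    refine ⟨l, 0, (√((l - r) / l) : ℝ), hl0, by simp [← h], ?_, by simp [hζ]⟩
    rw [Complex.norm_real, Real.norm_eq_abs, sq_abs, Real.sq_sqrt (by positivity)]
    field_simp
  · have hα : 0 < √((l - p) / l) := Real.sqrt_pos.2 (by positivity)
    have hα2 : √((l - p) / l) ^ 2 = (l - p) / l := Real.sq_sqrt (by positivity)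
    refine ⟨l, √((l - p) / l), -ζ / (l * √((l - p) / l) : ℝ), hl0, ?_, ?_, ?_⟩
    · rw [hα2]; field_simp
    · rw [norm_div, norm_neg, Complex.norm_real, Real.norm_eq_abs, div_pow, sq_abs, mul_pow, hα2,
        ← hdet]
      field_simp
    · have h1 : (l : ℂ) ≠ 0 := by exact_mod_cast hl0.ne'
      have h2 : ((√((l - p) / l) : ℝ) : ℂ) ≠ 0 := by exact_mod_cast hα.ne'
      rw [Complex.ofReal_mul]
      field_simp

/-- The joint range of three Hermitian forms is closed under addition. -/
lemma exists_qf_eq_add {B : Fin 3 → H →L[ℂ] H} (hB : ∀ i, IsSelfAdjoint (B i)) (x y : H) :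
    ∃ z, ∀ i, qf (B i) z = qf (B i) x + qf (B i) y := by
  obtain ⟨p, r, ζ, hs, hne, heq⟩ := exists_hermitian_relation
    (fun i => qf (B i) x) (fun i => qf (B i) y) (fun i => ⟪B i x, y⟫_ℂ)
  obtain ⟨l, α, β, hl, hα, hβ, hαβ⟩ := exists_rank_one_sub hs hne
  refine ⟨(α : ℂ) • x + β • y, fun i => ?_⟩
  have hcross : l * (α * (β * ⟪B i x, y⟫_ℂ).re) = -(ζ * ⟪B i x, y⟫_ℂ).re := by
    rw [← Complex.re_ofReal_mul, ← Complex.re_ofReal_mul, ← Complex.neg_re, ← neg_mul, ← hαβ]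
    ring_nf
  rw [qf_smul_add_smul (hB i)]
  refine mul_left_cancel₀ hl.ne' ?_
  linear_combination qf (B i) x * hα + qf (B i) y * hβ + 2 * hcross - heq i

/-- The joint range of three Hermitian forms, as a convex cone in `ℝ³`. -/
def jointRange (A B₁ B₂ : H →L[ℂ] H) (hA : IsSelfAdjoint A) (h1 : IsSelfAdjoint B₁)
    (h2 : IsSelfAdjoint B₂) : PointedCone ℝ (ℝ × ℝ × ℝ) where
  carrier := Set.range fun x => (qf A x, qf B₁ x, qf B₂ x)
  zero_mem' := ⟨0, by simp [qf]⟩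
  smul_mem' := by
    rintro ⟨c, hc⟩ _ ⟨x, rfl⟩
    refine ⟨√c • x, ?_⟩
    simp [qf_real_smul, Real.sq_sqrt hc]
  add_mem' := by
    rintro _ _ ⟨x, rfl⟩ ⟨y, rfl⟩
    obtain ⟨z, hz⟩ := exists_qf_eq_add (B := ![A, B₁, B₂])
      (by intro i; fin_cases i <;> assumption) x y
    exact ⟨z, Prod.ext (hz 0) (Prod.ext (hz 1) (hz 2))⟩

/-- The M. Riesz extension theorem for a functional given on a line. -/
lemma PointedCone.exists_nonneg_linearMap {E : Type*} [AddCommGroup E] [Module ℝ E]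
    (s : PointedCone ℝ E) {v : E} (hv : v ≠ 0) (c : ℝ)
    (nonneg : ∀ t : ℝ, t • v ∈ s → 0 ≤ t * c) (dense : ∀ y, ∃ t : ℝ, t • v + y ∈ s) :
    ∃ g : E →ₗ[ℝ] ℝ, g v = c ∧ ∀ x ∈ s, 0 ≤ g x := by
  let f : E →ₗ.[ℝ] ℝ := LinearPMap.mkSpanSingleton v c hv
  have hf (t : ℝ) (ht : t • v ∈ f.domain) : f ⟨t • v, ht⟩ = t * c :=
    LinearPMap.mkSpanSingleton'_apply (σ := RingHom.id ℝ) v c _ t ht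
  obtain ⟨g, hg, hgs⟩ := riesz_extension s f (by
    rintro ⟨u, hu⟩ hus
    obtain ⟨t, rfl⟩ := Submodule.mem_span_singleton.1 hu
    rw [hf]
    exact nonneg t hus) (fun y => by
    obtain ⟨t, ht⟩ := dense y
    exact ⟨⟨t • v, Submodule.mem_span_singleton.2 ⟨t, rfl⟩⟩, ht⟩)
  refine ⟨g, ?_, hgs⟩
  rw [hg ⟨v, Submodule.mem_span_singleton_self v⟩]
  exact LinearPMap.mkSpanSingleton_apply ℝ ℝ hv c

/-- A convex cone in the plane that contains `0` and lies in no closed half-plane is the whole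
plane. -/
lemma PointedCone.mem_of_forall_exists_neg (P : PointedCone ℝ (ℝ × ℝ))
    (hP : ∀ μ ν : ℝ, (μ ≠ 0 ∨ ν ≠ 0) → ∃ u ∈ P, μ * u.1 + ν * u.2 < 0) (v : ℝ × ℝ) :
    v ∈ P := by
  by_contra hv
  have hv0 : v ≠ 0 := fun h => hv (h ▸ P.zero_mem)
  have hv1 : v.1 ≠ 0 ∨ v.2 ≠ 0 := by
    by_contra! h
    exact hv0 (Prod.ext h.1 h.2)
  have hpos : 0 < v.1 ^ 2 + v.2 ^ 2 := by
    rcases hv1 with h | h <;> positivity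
  have key (y : ℝ × ℝ) : ∃ u ∈ P, v.1 * u.2 - v.2 * u.1 = v.1 * y.2 - v.2 * y.1 := by
    set d := v.1 * y.2 - v.2 * y.1 with hd
    rcases eq_or_ne d 0 with h | h
    · exact ⟨0, P.zero_mem, by simp [h]⟩
    obtain ⟨u, hu, hneg⟩ := hP (d * v.2) (-(d * v.1)) (by
      rcases hv1 with h' | h'
      · right; simp [h, h']
      · left; simp [h, h'])
    have hc : 0 < d * (v.1 * u.2 - v.2 * u.1) := by linarith
    have hne : v.1 * u.2 - v.2 * u.1 ≠ 0 := right_ne_zero_of_mul hc.ne'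
    refine ⟨(d / (v.1 * u.2 - v.2 * u.1)) • u, P.smul_mem ?_ hu, ?_⟩
    · exact (div_pos_iff.2 (mul_pos_iff.1 hc)).le
    · simp only [Prod.smul_fst, Prod.smul_snd, smul_eq_mul]
      field_simp
  obtain ⟨g, hgv, hgP⟩ := P.exists_nonneg_linearMap hv0 (-1) (fun t htP => by
    by_contra! ht
    have ht : 0 < t := by linarith
    apply hv
    have := P.smul_mem (inv_pos.2 ht).le htP
    rwa [smul_smul, inv_mul_cancel₀ ht.ne', one_smul] at this) (fun y => by
    obtain ⟨u, hu, hdet⟩ := key y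
    refine ⟨(v.1 * (u.1 - y.1) + v.2 * (u.2 - y.2)) / (v.1 ^ 2 + v.2 ^ 2), ?_⟩
    convert hu using 1
    ext
    · simp only [Prod.fst_add, Prod.smul_fst, smul_eq_mul]
      field_simp
      linear_combination v.2 * hdet
    · simp only [Prod.snd_add, Prod.smul_snd, smul_eq_mul]
      field_simp
      linear_combination -v.1 * hdet)
  have hgu (u : ℝ × ℝ) : g u = g (1, 0) * u.1 + g (0, 1) * u.2 := by
    have : u = u.1 • (1, 0) + u.2 • (0, 1) := by ext <;> simp
    conv_lhs => rw [this, map_add, map_smul, map_smul]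
    simp only [smul_eq_mul]; ring
  obtain ⟨u, hu, hneg⟩ := hP (g (1, 0)) (g (0, 1)) (by
    by_contra! h
    rw [hgu, h.1, h.2] at hgv
    norm_num at hgv)
  linarith [hgP u hu, hgu u]

lemma WeaklyIndefinite.exists_qf_eq {A B₁ B₂ : H →L[ℂ] H} (hA : IsSelfAdjoint A)
    (h1 : IsSelfAdjoint B₁) (h2 : IsSelfAdjoint B₂) (hw : WeaklyIndefinite ![B₁, B₂])
    (b c : ℝ) : ∃ x, qf B₁ x = b ∧ qf B₂ x = c := by
  have := ((jointRange A B₁ B₂ hA h1 h2).map (LinearMap.snd ℝ ℝ (ℝ × ℝ))).mem_of_forall_exists_neg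
    (fun μ ν h => by
      obtain ⟨-, x, hx⟩ := hw ![μ, ν] (by
        intro h0
        have := congrFun h0 0
        have := congrFun h0 1
        simp_all)
      refine ⟨(qf B₁ x, qf B₂ x), ⟨_, ⟨x, rfl⟩, rfl⟩, ?_⟩
      simpa [Fin.sum_univ_two, qf_add, qf_smul_s7] using hx) (b, c)
  obtain ⟨_, ⟨x, rfl⟩, hx⟩ := this
  exact ⟨x, congrArg Prod.fst hx, congrArg Prod.snd hx⟩

/-- Krein–Šmul'jan type theorem for two operators: if `{B₁, B₂}` is weakly indefinite,
then `A ≥ 0` on `Q₁ ∩ Q₂` iff `A + λ₁B₁ + λ₂B₂ ≥ 0` for some `λ₁, λ₂ ∈ ℝ`. -/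
theorem krein_smuljan_two (A B₁ B₂ : H →L[ℂ] H) (hA : IsSelfAdjoint A)
    (h1 : IsSelfAdjoint B₁) (h2 : IsSelfAdjoint B₂)
    (hw : WeaklyIndefinite ![B₁, B₂]) :
    (∀ x : H, qf B₁ x = 0 → qf B₂ x = 0 → 0 ≤ qf A x) ↔
      ∃ l₁ l₂ : ℝ, PosSemidef (A + l₁ • B₁ + l₂ • B₂) := by
  constructor
  · intro h
    have he : ((1, 0, 0) : ℝ × ℝ × ℝ) ≠ 0 := by simp
    obtain ⟨g, hg1, hgC⟩ := (jointRange A B₁ B₂ hA h1 h2).exists_nonneg_linearMap he 1 (by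
        rintro t ⟨x, hx⟩
        simp only [Prod.smul_mk, smul_eq_mul, mul_one, mul_zero, Prod.mk.injEq] at hx ⊢
        exact hx.1 ▸ h x hx.2.1 hx.2.2) (by
        rintro ⟨a, b, c⟩
        obtain ⟨x, rfl, rfl⟩ := hw.exists_qf_eq hA h1 h2 b c
        exact ⟨qf A x - a, x, by simp⟩)
    refine ⟨g (0, 1, 0), g (0, 0, 1), fun x => ?_⟩
    have hx : 0 ≤ g (qf A x, qf B₁ x, qf B₂ x) := hgC _ ⟨x, rfl⟩
    have hdecomp : (qf A x, qf B₁ x, qf B₂ x) = qf A x • ((1, 0, 0) : ℝ × ℝ × ℝ) +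
        qf B₁ x • ((0, 1, 0) : ℝ × ℝ × ℝ) + qf B₂ x • ((0, 0, 1) : ℝ × ℝ × ℝ) := by simp
    rw [hdecomp, map_add, map_add, map_smul, map_smul, map_smul, hg1] at hx
    simp only [smul_eq_mul] at hx
    rw [qf_add, qf_add, qf_smul_s7, qf_smul_s7]
    linarith
  · rintro ⟨l₁, l₂, h⟩ x hx₁ hx₂
    simpa [qf_add, qf_smul_s7, hx₁, hx₂] using h x
end

section
/- Let B₁,…,B_m ∈ 𝓛(ℋ) be selfadjoint with m ≥ 2. If {B₁,…,B_m} is strongly indefinite, then {B₁,…,B_m} is indefinite, i.e. B_j is indefinite on ⋂_{i≠j} Qᵢ for every j = 1,…,m. -/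
open scoped InnerProductSpace

variable {H : Type*} [NormedAddCommGroup H] [InnerProductSpace ℂ H] [CompleteSpace H]

/-- A family `{B₁,…,B_m}` is strongly indefinite if it is weakly indefinite and for all
indices `i, j, k`, whenever `x₋ ∈ 𝒫ᵢ⁻ ∩ Q_j ∩ Q_k` and `x₊ ∈ 𝒫ᵢ⁺ ∩ Q_j ∩ Q_k` there is
`θ ∈ [0, π)` with `Re⟨B_j x₊, e^{iθ} x₋⟩ = Re⟨B_k x₊, e^{iθ} x₋⟩ = 0`. -/
def StronglyIndefinite {m : ℕ} (B : Fin m → (H →L[ℂ] H)) : Prop :=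
  WeaklyIndefinite B ∧
  ∀ i j k : Fin m, ∀ xm xp : H,
    qf (B i) xm < 0 → qf (B j) xm = 0 → qf (B k) xm = 0 →
    0 < qf (B i) xp → qf (B j) xp = 0 → qf (B k) xp = 0 →
    ∃ θ : ℝ, θ ∈ Set.Ico 0 Real.pi ∧
      (⟪(B j) xp, Complex.exp (θ * Complex.I) • xm⟫_ℂ).re = 0 ∧
      (⟪(B k) xp, Complex.exp (θ * Complex.I) • xm⟫_ℂ).re = 0

set_option linter.unusedSectionVars false

theorem qf_add_s17 (A C : H →L[ℂ] H) (x : H) : qf (A + C) x = qf A x + qf C x := by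
  simp [qf]

theorem qf_neg (A : H →L[ℂ] H) (x : H) : qf (-A) x = -qf A x := by
  simp [qf]

theorem qf_real_smul_s17 (r : ℝ) (A : H →L[ℂ] H) (x : H) : qf (r • A) x = r * qf A x := by
  simp [qf, inner_smul_left_eq_smul]

theorem qf_sum {ι : Type*} (s : Finset ι) (A : ι → H →L[ℂ] H) (x : H) :
    qf (∑ i ∈ s, A i) x = ∑ i ∈ s, qf (A i) x := by
  simp [qf]

theorem qf_smul_vec (A : H →L[ℂ] H) {c : ℂ} (hc : ‖c‖ = 1) (x : H) :
    qf A (c • x) = qf A x := by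
  have h : c * (starRingEnd ℂ) c = 1 := by
    rw [Complex.mul_conj, Complex.normSq_eq_norm_sq, hc]; simp
  simp only [qf, map_smul, inner_smul_left, inner_smul_right]
  rw [← mul_assoc, h, one_mul]

theorem qf_add_real_smul_s17 {A : H →L[ℂ] H} (hA : IsSelfAdjoint A) (x y : H) (t : ℝ) :
    qf A (x + (t : ℂ) • y) = qf A x + 2 * t * (⟪A x, y⟫_ℂ).re + t ^ 2 * qf A y := by
  have h : (⟪A y, x⟫_ℂ).re = (⟪A x, y⟫_ℂ).re := by
    have h1 : ⟪A y, x⟫_ℂ = ⟪y, A x⟫_ℂ := hA.isSymmetric y x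
    rw [h1, ← inner_conj_symm, Complex.conj_re]
  simp only [qf, map_add, map_smul, inner_add_left, inner_add_right, inner_smul_left,
    inner_smul_right, Complex.conj_ofReal, Complex.add_re, Complex.re_ofReal_mul, h]
  ring

/-- If `a + 2 b t - c t ^ 2` has `a, c > 0`, it has roots `u` and `-v` with `u, v > 0` and
`u * v = a / c`. -/
theorem exists_roots_of_pos {a b c : ℝ} (ha : 0 < a) (hc : 0 < c) :
    ∃ u v : ℝ, 0 < u ∧ 0 < v ∧ c * (u * v) = a ∧
      a + 2 * u * b - u ^ 2 * c = 0 ∧ a - 2 * v * b - v ^ 2 * c = 0 := by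
  have hpos : 0 < b ^ 2 + a * c := by positivity
  set d := √(b ^ 2 + a * c)
  have hd : d ^ 2 = b ^ 2 + a * c := Real.sq_sqrt hpos.le
  have hlt : |b| < d := by
    apply Real.lt_sqrt_of_sq_lt
    rw [sq_abs]
    nlinarith [mul_pos ha hc]
  obtain ⟨h1, h2⟩ := abs_lt.mp hlt
  refine ⟨(d + b) / c, (d - b) / c, div_pos (by linarith) hc, div_pos (by linarith) hc, ?_, ?_, ?_⟩
  · field_simp
    linear_combination hd
  · field_simp
    linear_combination -hd
  · field_simp
    linear_combination -hd

/-- Complex numbers that are pairwise annihilated by a common rotated real part are all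
annihilated by the same rotated real part. -/
theorem exists_common_rotation {ι : Type*} (s : Finset ι) (z : ι → ℂ)
    (h : ∀ j ∈ s, ∀ k ∈ s, ∃ c : ℂ, ‖c‖ = 1 ∧ (c * z j).re = 0 ∧ (c * z k).re = 0) :
    ∃ c : ℂ, ‖c‖ = 1 ∧ ∀ j ∈ s, (c * z j).re = 0 := by
  by_cases h0 : ∀ j ∈ s, z j = 0
  · exact ⟨1, by simp, fun j hj => by simp [h0 j hj]⟩
  push Not at h0
  obtain ⟨j, hj, hzj⟩ := h0
  obtain ⟨c, hc, hcj, -⟩ := h j hj j hj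
  refine ⟨c, hc, fun k hk => ?_⟩
  obtain ⟨e, he, hej, hek⟩ := h j hj k hk
  have he0 : e ≠ 0 := by rintro rfl; simp at he
  have him : (e * z j).im ≠ 0 := fun h' => mul_ne_zero he0 hzj (Complex.ext hej h')
  have hce : ((e * z j).im : ℂ) * c = ((c * z j).im : ℂ) * e := by
    apply mul_right_cancel₀ hzj
    rw [mul_assoc, mul_assoc]
    apply Complex.ext
    · rw [Complex.re_ofReal_mul, Complex.re_ofReal_mul, hcj, hej]; ring
    · rw [Complex.im_ofReal_mul, Complex.im_ofReal_mul]; ring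
  have hre : (e * z j).im * (c * z k).re = 0 := by
    rw [← Complex.re_ofReal_mul, ← mul_assoc, hce, mul_assoc, Complex.re_ofReal_mul, hek, mul_zero]
  exact (mul_eq_zero.mp hre).resolve_left him

theorem StronglyIndefinite.exists_common_rotation {m : ℕ} {B : Fin m → (H →L[ℂ] H)}
    (hstr : StronglyIndefinite B) (a : Fin m) (s : Finset (Fin m)) {x y : H}
    (hxa : 0 < qf (B a) x) (hya : qf (B a) y < 0)
    (hx : ∀ i ∈ s, qf (B i) x = 0) (hy : ∀ i ∈ s, qf (B i) y = 0) :
    ∃ c : ℂ, ‖c‖ = 1 ∧ ∀ i ∈ s, (⟪B i x, c • y⟫_ℂ).re = 0 := by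
  simp only [inner_smul_right]
  refine _root_.exists_common_rotation s (fun i => ⟪B i x, y⟫_ℂ) fun j hj k hk => ?_
  obtain ⟨θ, -, h1, h2⟩ := hstr.2 a j k y x hya (hy j hj) (hy k hk) hxa (hx j hj) (hx k hk)
  rw [inner_smul_right] at h1 h2
  exact ⟨_, Complex.norm_exp_ofReal_mul_I θ, h1, h2⟩

/-- If the form of `A` is nonnegative on the common neutral vectors of `B a` and `B i`, `i ∈ s`,
then its slopes with respect to `B a` on the two sides of `Q(B a)` are ordered. -/
theorem StronglyIndefinite.div_le_div {m : ℕ} {B : Fin m → (H →L[ℂ] H)}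
    (hB : ∀ i, IsSelfAdjoint (B i)) (hstr : StronglyIndefinite B) {A : H →L[ℂ] H}
    (hA : IsSelfAdjoint A) (a : Fin m) (s : Finset (Fin m))
    (hpos : ∀ x, qf (B a) x = 0 → (∀ i ∈ s, qf (B i) x = 0) → 0 ≤ qf A x) {x y : H}
    (hxa : 0 < qf (B a) x) (hya : qf (B a) y < 0)
    (hx : ∀ i ∈ s, qf (B i) x = 0) (hy : ∀ i ∈ s, qf (B i) y = 0) :
    qf A y / qf (B a) y ≤ qf A x / qf (B a) x := by
  obtain ⟨c, hc, hcs⟩ := hstr.exists_common_rotation a s hxa hya hx hy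
  obtain ⟨u, v, hu, hv, huv, hru, hrv⟩ :=
    exists_roots_of_pos (b := (⟪B a x, c • y⟫_ℂ).re) hxa (neg_pos.mpr hya)
  have key (t : ℝ) (ht : qf (B a) x + 2 * t * (⟪B a x, c • y⟫_ℂ).re + t ^ 2 * qf (B a) y = 0) :
      0 ≤ qf A x + 2 * t * (⟪A x, c • y⟫_ℂ).re + t ^ 2 * qf A y := by
    rw [← qf_smul_vec A hc y, ← qf_add_real_smul_s17 hA]
    refine hpos _ ?_ fun i hi => ?_
    · rw [qf_add_real_smul_s17 (hB a), qf_smul_vec _ hc, ht]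
    · rw [qf_add_real_smul_s17 (hB i), qf_smul_vec _ hc, hx i hi, hy i hi, hcs i hi]; ring
  have h1 := mul_nonneg hv.le (key u (by linarith))
  have h2 := mul_nonneg hu.le (key (-v) (by linarith))
  have h3 : 0 ≤ (u + v) * (qf A x + u * v * qf A y) := by nlinarith
  have h4 : 0 ≤ qf A x + u * v * qf A y := nonneg_of_mul_nonneg_right h3 (by linarith)
  have h5 : 0 ≤ -qf (B a) y * (qf A x + u * v * qf A y) :=
    mul_nonneg (by linarith) h4
  rw [← neg_div_neg_eq, div_le_div_iff₀ (by linarith) hxa, ← huv]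
  have h6 : -qf (B a) y * (qf A x + u * v * qf A y) =
    -qf (B a) y * qf A x + (-qf (B a) y * (u * v)) * qf A y := by ring
  rw [h6] at h5
  linarith

theorem WeaklyIndefinite.exists_neg {m : ℕ} {B : Fin m → (H →L[ℂ] H)}
    (h : WeaklyIndefinite B) {s : Finset (Fin m)} {a : Fin m} (ha : a ∉ s) {r : ℝ} (hr : r ≠ 0)
    (μ : Fin m → ℝ) : ∃ x, r * qf (B a) x + ∑ i ∈ s, μ i * qf (B i) x < 0 := by
  classical
  obtain ⟨-, x, hx⟩ := h (fun i => if i = a then r else if i ∈ s then μ i else 0) fun h0 => hr <| by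
    simpa using congrFun h0 a
  refine ⟨x, lt_of_eq_of_lt ?_ hx⟩
  rw [qf_sum, ← Finset.sum_subset (Finset.subset_univ (insert a s)), Finset.sum_insert ha]
  · congr 1
    · simp [qf_real_smul_s17]
    · refine Finset.sum_congr rfl fun i hi => ?_
      simp [qf_real_smul_s17, hi, ne_of_mem_of_not_mem hi ha]
  · intro i _ hi
    rw [Finset.mem_insert, not_or] at hi
    simp [hi.1, hi.2, qf]

/-- S-procedure: a form that is nonnegative on the common neutral vectors of a strongly indefinite
subfamily becomes nonnegative everywhere after adding a combination of the subfamily. -/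
theorem StronglyIndefinite.exists_multipliers {m : ℕ} {B : Fin m → (H →L[ℂ] H)}
    (hB : ∀ i, IsSelfAdjoint (B i)) (hstr : StronglyIndefinite B) (s : Finset (Fin m)) :
    ∀ A : H →L[ℂ] H, IsSelfAdjoint A → (∀ x, (∀ i ∈ s, qf (B i) x = 0) → 0 ≤ qf A x) →
      ∃ μ : Fin m → ℝ, ∀ x, 0 ≤ qf A x + ∑ i ∈ s, μ i * qf (B i) x := by
  classical
  induction s using Finset.induction_on with
  | empty => exact fun A _ h => ⟨0, fun x => by simpa using h x⟩
  | insert a s ha ih =>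
    intro A hA hpos
    have hneg : ∃ y, (∀ i ∈ s, qf (B i) y = 0) ∧ qf (B a) y < 0 := by
      by_contra! hcon
      obtain ⟨μ, hμ⟩ := ih (B a) (hB a) hcon
      obtain ⟨x, hx⟩ := hstr.1.exists_neg ha one_ne_zero μ
      linarith [hμ x]
    have hposa : ∃ x, (∀ i ∈ s, qf (B i) x = 0) ∧ 0 < qf (B a) x := by
      by_contra! hcon
      obtain ⟨μ, hμ⟩ := ih (-B a) (hB a).neg fun x hx => by
        rw [qf_neg]; linarith [hcon x hx]
      obtain ⟨x, hx⟩ := hstr.1.exists_neg ha (neg_ne_zero.mpr one_ne_zero) μ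
      have := hμ x
      rw [qf_neg] at this
      linarith
    obtain ⟨ν, hν₁, hν₂⟩ := exists_between_of_forall_le
      (s := (fun y => qf A y / qf (B a) y) '' {y | (∀ i ∈ s, qf (B i) y = 0) ∧ qf (B a) y < 0})
      (t := (fun x => qf A x / qf (B a) x) '' {x | (∀ i ∈ s, qf (B i) x = 0) ∧ 0 < qf (B a) x})
      (Set.Nonempty.image _ hneg) (Set.Nonempty.image _ hposa) (by
        rintro _ ⟨y, hy, rfl⟩ _ ⟨x, hx, rfl⟩
        exact hstr.div_le_div hB hA a s
          (fun z hza hz => hpos z (by simpa using ⟨hza, hz⟩)) hx.2 hy.2 hx.1 hy.1)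
    obtain ⟨μ, hμ⟩ := ih (A + (-ν) • B a) (hA.add ((IsSelfAdjoint.all (-ν)).smul (hB a))) fun x hx => by
      rw [qf_add_s17, qf_real_smul_s17]
      rcases lt_trichotomy (qf (B a) x) 0 with h | h | h
      · have := hν₁ ⟨x, ⟨hx, h⟩, rfl⟩
        rw [div_le_iff_of_neg h] at this
        linarith
      · have := hpos x (by simpa using ⟨h, hx⟩)
        simpa [h] using this
      · have := hν₂ ⟨x, ⟨hx, h⟩, rfl⟩
        rw [le_div_iff₀ h] at this
        linarith
    refine ⟨Function.update μ a (-ν), fun x => ?_⟩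
    have hsum : ∑ i ∈ s, Function.update μ a (-ν) i * qf (B i) x = ∑ i ∈ s, μ i * qf (B i) x :=
      Finset.sum_congr rfl fun i hi => by
        rw [Function.update_of_ne (ne_of_mem_of_not_mem hi ha)]
    have := hμ x
    rw [qf_add_s17, qf_real_smul_s17] at this
    rw [Finset.sum_insert ha, Function.update_self, hsum]
    linarith

/-- A strongly indefinite family is indefinite. -/
theorem indefiniteFamily_of_stronglyIndefinite {m : ℕ} (hm : 2 ≤ m)
    (B : Fin m → (H →L[ℂ] H)) (hB : ∀ i, IsSelfAdjoint (B i))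
    (hstr : StronglyIndefinite B) :
    IndefiniteFamily B := by
  intro j
  have hj : j ∉ Finset.univ.erase j := Finset.notMem_erase j _
  constructor
  · by_contra! hcon
    obtain ⟨μ, hμ⟩ := hstr.exists_multipliers hB (Finset.univ.erase j) (-B j) (hB j).neg
      fun x hx => by
        rw [qf_neg]
        linarith [hcon x fun i hi => hx i (by simpa using hi)]
    obtain ⟨x, hx⟩ := hstr.1.exists_neg hj (neg_ne_zero.mpr one_ne_zero) μ
    have := hμ x
    rw [qf_neg] at this
    linarith
  · by_contra! hcon
    obtain ⟨μ, hμ⟩ := hstr.exists_multipliers hB (Finset.univ.erase j) (B j) (hB j)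
      fun x hx => hcon x fun i hi => hx i (by simpa using hi)
    obtain ⟨x, hx⟩ := hstr.1.exists_neg hj one_ne_zero μ
    linarith [hμ x]
end
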